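/- arXiv:1912.08634 — 2 statements merged into one kernel-verified Lean document; each statement's English description precedes it below -/
import Mathlib

section
/- For even j ≥ 10, ℓ ∈ ℤ with |ℓ| ≤ 2^{j/2}, and i ∈ {h,v}, the support of Ψ_{j,ℓ}^{(i)}, expressed in polar coordinates ξ = ρ(cos θ, sin θ)ᵀ, is contained in the wedge W_{j,ℓ}^{(h)} := {(ρ,θ) ∈ ℝ × [−π/2, π/2] : 2^j/3 < |ρ| < 2^{j+1}, θ_{j,ℓ−2}^{(h)} < θ < θ_{j,ℓ+2}^{(h)}} for i = h, and in W_{j,ℓ}^{(v)} := {(ρ,θ) ∈ ℝ × [0, π] : 2^j/3 < |ρ| < 2^{j+1}, θ_{j,ℓ+2}^{(v)} < θ < θ_{j,ℓ−2}^{(v)}} for i = v. -/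
open Real MeasureTheory Set
open scoped Classical

noncomputable section

/-- A window function `g ∈ 𝒲`: nonnegative, even, with support `(-2/3, 2/3)`,
and whose integer translates form a partition of unity. -/
structure IsWindow (g : ℝ → ℝ) : Prop where
  nonneg : ∀ x, 0 ≤ g x
  even_fun : ∀ x, g (-x) = g x
  supp_eq : Function.support g = Ioo (-(2/3) : ℝ) (2/3)
  partition : ∀ x : ℝ, HasSum (fun z : ℤ => g (x + (z : ℝ))) 1

/-- `g ∈ 𝒲^q`: a window function that is `q`-times continuously differentiable. -/
def IsWindowQ (g : ℝ → ℝ) (q : ℕ) : Prop := IsWindow g ∧ ContDiff ℝ q g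

/-- `g̃(x) = g(x/2) - g(x)`. -/
def gtilde (g : ℝ → ℝ) : ℝ → ℝ := fun x => g (x / 2) - g x

/-- Horizontal bivariate window `Ψ^{(h)}(x) = g̃(x₁) g(x₂)`. -/
def PsiH (g : ℝ → ℝ) : ℝ × ℝ → ℝ := fun x => gtilde g x.1 * g x.2

/-- Vertical bivariate window `Ψ^{(v)}(x) = g(x₁) g̃(x₂)`. -/
def PsiV (g : ℝ → ℝ) : ℝ × ℝ → ℝ := fun x => g x.1 * gtilde g x.2

/-- `Ψ_{j,ℓ}^{(i)}(ξ) = Ψ^{(i)}((N_{j,ℓ}^{(i)})^{-T} ξ)`, where the inverse transpose of the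
shear matrices has been written out explicitly.  `i = true` is the horizontal case `(h)`,
`i = false` the vertical case `(v)`. -/
def PsiJL (g : ℝ → ℝ) (i : Bool) (j : ℕ) (ℓ : ℤ) : ℝ × ℝ → ℝ := fun ξ =>
  if i then
    PsiH g ((2:ℝ) ^ (-(j:ℝ)) * ξ.1,
            (2:ℝ) ^ (-(j:ℝ)/2) * ξ.2 - (ℓ:ℝ) * (2:ℝ) ^ (-(j:ℝ)) * ξ.1)
  else
    PsiV g ((2:ℝ) ^ (-(j:ℝ)/2) * ξ.1 - (ℓ:ℝ) * (2:ℝ) ^ (-(j:ℝ)) * ξ.2,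
            (2:ℝ) ^ (-(j:ℝ)) * ξ.2)

/-- Discrete angles `θ_{j,ℓ}^{(h)} = arctan(ℓ 2^{-j/2})`,
`θ_{j,ℓ}^{(v)} = arccot(ℓ 2^{-j/2}) = π/2 - arctan(ℓ 2^{-j/2})`. -/
def thetaJL (i : Bool) (j : ℕ) (ℓ : ℤ) : ℝ :=
  if i then arctan ((ℓ:ℝ) * (2:ℝ) ^ (-(j:ℝ)/2))
  else π/2 - arctan ((ℓ:ℝ) * (2:ℝ) ^ (-(j:ℝ)/2))

/-- The pattern `𝒫(N_{j,ℓ}^{(i)}) = (N_{j,ℓ}^{(i)})^{-1} ℤ² ∩ [-1/2,1/2)²`: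
`y` belongs to the pattern iff `N_{j,ℓ}^{(i)} y ∈ ℤ²` and `y ∈ [-1/2,1/2)²`. -/
def pattern (i : Bool) (j : ℕ) (ℓ : ℤ) : Set (ℝ × ℝ) :=
  {y : ℝ × ℝ |
    (∃ k : ℤ × ℤ,
      (if i then ((2:ℝ)^(j:ℝ) * y.1 + (ℓ:ℝ) * (2:ℝ)^((j:ℝ)/2) * y.2, (2:ℝ)^((j:ℝ)/2) * y.2)
       else ((2:ℝ)^((j:ℝ)/2) * y.1, (ℓ:ℝ) * (2:ℝ)^((j:ℝ)/2) * y.1 + (2:ℝ)^(j:ℝ) * y.2))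
        = ((k.1 : ℝ), (k.2 : ℝ)))
    ∧ y.1 ∈ Ico (-(1/2) : ℝ) (1/2) ∧ y.2 ∈ Ico (-(1/2) : ℝ) (1/2)}

/-- `ỹ = y - (2^{-j-1},0)ᵀ` in the horizontal case, `ỹ = y - (0,2^{-j-1})ᵀ` in the vertical one. -/
def ytilde (i : Bool) (j : ℕ) (y : ℝ × ℝ) : ℝ × ℝ :=
  if i then (y.1 - (2:ℝ) ^ (-(j:ℝ) - 1), y.2) else (y.1, y.2 - (2:ℝ) ^ (-(j:ℝ) - 1))

/-- The trigonometric polynomial shearlet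
`ψ_{j,ℓ,y}^{(i)}(x) = ∑_{k∈ℤ²} Ψ_{j,ℓ}^{(i)}(k) e^{i k·(x - 2πỹ)}`. -/
def shearlet (g : ℝ → ℝ) (i : Bool) (j : ℕ) (ℓ : ℤ) (y : ℝ × ℝ) : ℝ × ℝ → ℂ := fun x =>
  ∑' k : ℤ × ℤ, (PsiJL g i j ℓ ((k.1 : ℝ), (k.2 : ℝ)) : ℂ) *
    Complex.exp (Complex.I *
      (((k.1 : ℝ) * (x.1 - 2*π*(ytilde i j y).1)
        + (k.2 : ℝ) * (x.2 - 2*π*(ytilde i j y).2) : ℝ) : ℂ))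

/-- `⟨f,h⟩₂ = (2π)^{-2} ∫_{𝕋²} f(x) conj(h(x)) dx`, with the torus realised as `[-π,π]²`. -/
def inner2 (f h : ℝ × ℝ → ℂ) : ℂ :=
  ((2*π)^2 : ℂ)⁻¹ * ∫ x in (Icc (-π) π ×ˢ Icc (-π) π : Set (ℝ × ℝ)), f x * (starRingEnd ℂ) (h x)

/-- The `2π`-periodization `f^{2π} = ∑_{n∈ℤ²} f(· + 2πn)`. -/
def periodize (f : ℝ × ℝ → ℝ) : ℝ × ℝ → ℝ := fun x =>
  ∑' n : ℤ × ℤ, f (x.1 + 2*π*(n.1 : ℝ), x.2 + 2*π*(n.2 : ℝ))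

/-- Euclidean norm `|x|₂` on `ℝ²`. -/
def nrm2 (x : ℝ × ℝ) : ℝ := Real.sqrt (x.1^2 + x.2^2)

/-- First partial derivative of a complex-valued function of two real variables. -/
def pd1 (f : ℝ × ℝ → ℂ) : ℝ × ℝ → ℂ := fun x => deriv (fun t => f (t, x.2)) x.1

/-- Second partial derivative of a complex-valued function of two real variables. -/
def pd2 (f : ℝ × ℝ → ℂ) : ℝ × ℝ → ℂ := fun x => deriv (fun t => f (x.1, t)) x.2

/-- `∂^r = ∂^{r₁+r₂}/∂x₁^{r₁}∂x₂^{r₂}` (complex-valued). -/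
def pd (r : ℕ × ℕ) (f : ℝ × ℝ → ℂ) : ℝ × ℝ → ℂ := pd1^[r.1] (pd2^[r.2] f)

/-- First partial derivative of a real-valued function of two real variables. -/
def pdR1 (f : ℝ × ℝ → ℝ) : ℝ × ℝ → ℝ := fun x => deriv (fun t => f (t, x.2)) x.1

/-- Second partial derivative of a real-valued function of two real variables. -/
def pdR2 (f : ℝ × ℝ → ℝ) : ℝ × ℝ → ℝ := fun x => deriv (fun t => f (x.1, t)) x.2

/-- `∂^r = ∂^{r₁+r₂}/∂x₁^{r₁}∂x₂^{r₂}` (real-valued). -/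
def pdR (r : ℕ × ℕ) (f : ℝ × ℝ → ℝ) : ℝ × ℝ → ℝ := pdR1^[r.1] (pdR2^[r.2] f)

/-- The Fourier transform `𝓕f(x) = (2π)^{-2} ∫_{ℝ²} f(ξ) e^{-iξ·x} dξ`. -/
def FT (f : ℝ × ℝ → ℂ) : ℝ × ℝ → ℂ := fun x =>
  ((2*π)^2 : ℂ)⁻¹ * ∫ ξ : ℝ × ℝ, f ξ * Complex.exp (-(Complex.I) * ((ξ.1*x.1 + ξ.2*x.2 : ℝ) : ℂ))

/-- Rotation matrix `R_γ` acting on `ℝ²`. -/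
def rotM (γ : ℝ) (x : ℝ × ℝ) : ℝ × ℝ :=
  (Real.cos γ * x.1 - Real.sin γ * x.2, Real.sin γ * x.1 + Real.cos γ * x.2)

/-- Transposed rotation matrix `R_γᵀ` acting on `ℝ²`. -/
def rotT (γ : ℝ) (x : ℝ × ℝ) : ℝ × ℝ :=
  (Real.cos γ * x.1 + Real.sin γ * x.2, -(Real.sin γ) * x.1 + Real.cos γ * x.2)

/-- The standard edge fragment `ℰ_j(x) = f(x) φ(2^{j/2}x) χ_{{x₁ ≥ E(x₂)}}(x)`. -/
def edgeFragment (f φ : ℝ × ℝ → ℝ) (E : ℝ → ℝ) (j : ℕ) : ℝ × ℝ → ℝ := fun x =>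
  f x * φ ((2:ℝ)^((j:ℝ)/2) * x.1, (2:ℝ)^((j:ℝ)/2) * x.2) * (if E x.2 ≤ x.1 then 1 else 0)

/-- The second-order differential operator `L = I + 2^j Δ`. -/
def Lop (j : ℕ) (f : ℝ × ℝ → ℂ) : ℝ × ℝ → ℂ := fun x =>
  f x + (Complex.ofReal ((2:ℝ)^(j:ℝ))) * (pd (2,0) f x + pd (0,2) f x)

/-- The dyadic square `Q` indexed by `(n₁,n₂)` at scale `j`. -/
def dyadicSquare (j : ℕ) (n : ℕ × ℕ) : Set (ℝ × ℝ) :=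
  Ico (2*π*(n.1:ℝ)*(2:ℝ)^(-(j:ℝ)/2) - π) (2*π*((n.1:ℝ)+1)*(2:ℝ)^(-(j:ℝ)/2) - π) ×ˢ
  Ico (2*π*(n.2:ℝ)*(2:ℝ)^(-(j:ℝ)/2) - π) (2*π*((n.2:ℝ)+1)*(2:ℝ)^(-(j:ℝ)/2) - π)

/-- The indices of the dyadic squares at scale `j` meeting `∂T` (the set `𝒬_j^1`). -/
def Q1set (T : Set (ℝ × ℝ)) (j : ℕ) : Finset (ℕ × ℕ) :=
  (Finset.range (2^(j/2)) ×ˢ Finset.range (2^(j/2))).filter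
    (fun n => (frontier T ∩ dyadicSquare j n).Nonempty)

/-- Fresnel integral `Fc(x) = ∫₀ˣ cos v/√v dv`. -/
def Fc (x : ℝ) : ℝ := ∫ v in (0:ℝ)..x, Real.cos v / Real.sqrt v

/-- Fresnel integral `Fs(x) = ∫₀ˣ sin v/√v dv`. -/
def Fs (x : ℝ) : ℝ := ∫ v in (0:ℝ)..x, Real.sin v / Real.sqrt v

/-- `F⁺ = Fc + Fs`. -/
def Fp (x : ℝ) : ℝ := Fc x + Fs x

/-- `F⁻ = Fc - Fs`. -/
def Fm (x : ℝ) : ℝ := Fc x - Fs x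

/-- `a(λ,p,A)` of the paper. -/
def aInt (g : ℝ → ℝ) (l p A : ℝ) : ℝ :=
  ∫ v in Ioi (0:ℝ),
    (g (2*Real.sqrt (A*l*v) + p*l) + g (2*Real.sqrt (A*l*v) - p*l)) * (Real.cos v / Real.sqrt v)

/-- `b(λ,p,A)` of the paper. -/
def bInt (g : ℝ → ℝ) (l p A : ℝ) : ℝ :=
  ∫ v in Ioi (0:ℝ),
    (g (2*Real.sqrt (A*l*v) + p*l) + g (2*Real.sqrt (A*l*v) - p*l)) * (Real.sin v / Real.sqrt v)

/-- `P₁(D,p,A)` of the paper. -/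
def P1 (g : ℝ → ℝ) (D p A : ℝ) : ℝ :=
  ∫ l in (1/3 : ℝ)..(4/3),
    gtilde g l * l⁻¹ *
      ((aInt g l p A + bInt g l p A) * Real.cos (D*l)
        + (aInt g l p A - bInt g l p A) * Real.sin (D*l))

/-- `P₂(D,p,A)` of the paper. -/
def P2 (g : ℝ → ℝ) (D p A : ℝ) : ℝ :=
  ∫ l in (1/3 : ℝ)..(4/3),
    gtilde g l * l⁻¹ *
      ((aInt g l p A + bInt g l p A) * Real.sin (D*l)
        - (aInt g l p A - bInt g l p A) * Real.cos (D*l))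


theorem IsWindow.eq_zero {g : ℝ → ℝ} (hg : IsWindow g) {x : ℝ} (hx : 2 / 3 ≤ |x|) : g x = 0 := by
  by_contra h
  have hmem : x ∈ Function.support g := h
  rw [hg.supp_eq, mem_Ioo, ← abs_lt] at hmem
  linarith

theorem IsWindow.abs_lt {g : ℝ → ℝ} (hg : IsWindow g) {x : ℝ} (hx : g x ≠ 0) : |x| < 2 / 3 := by
  by_contra! h
  exact hx (hg.eq_zero h)

theorem IsWindow.eq_one {g : ℝ → ℝ} (hg : IsWindow g) {x : ℝ} (hx : |x| ≤ 1 / 3) : g x = 1 := by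
  have hsingle : HasSum (fun z : ℤ => g (x + (z : ℝ))) (g (x + ((0 : ℤ) : ℝ))) := by
    refine hasSum_single 0 fun z hz => hg.eq_zero ?_
    have hz1 : (1 : ℝ) ≤ |(z : ℝ)| := by exact_mod_cast Int.one_le_abs hz
    have htri : |(z : ℝ)| ≤ |x + z| + |x| := by
      simpa using abs_sub (x + (z : ℝ)) x
    linarith
  simpa using hsingle.unique (hg.partition x)

/-- The function `g̃` vanishes outside `{1/3 < |x| < 4/3}`. -/
theorem IsWindow.abs_bounds_of_gtilde_ne_zero {g : ℝ → ℝ} (hg : IsWindow g) {x : ℝ}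
    (hx : gtilde g x ≠ 0) : 1 / 3 < |x| ∧ |x| < 4 / 3 := by
  have habs : |x / 2| = |x| / 2 := by rw [abs_div, abs_two]
  constructor
  · by_contra! h
    apply hx
    rw [gtilde, hg.eq_one h, hg.eq_one (by rw [habs]; linarith [abs_nonneg x]), sub_self]
  · by_contra! h
    apply hx
    rw [gtilde, hg.eq_zero (x := x) (by linarith), hg.eq_zero (by rw [habs]; linarith), sub_self]

/-- Radial bounds for points whose sheared and scaled coordinates lie in the window's support. -/
theorem radius_bounds {s l ρ x y a t : ℝ} (hs : 32 ≤ s) (hl : |l| ≤ s)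
    (hxy : x ^ 2 + y ^ 2 = 1) (hx : ρ * x = s ^ 2 * a) (hy : ρ * y = s * (t + l * a))
    (ha : 1 / 3 < |a|) (ha' : |a| < 4 / 3) (ht : |t| < 2 / 3) :
    s ^ 2 / 3 < |ρ| ∧ |ρ| < 2 * s ^ 2 := by
  have hs0 : 0 < s := by linarith
  have hρ : ρ ^ 2 = (s ^ 2 * a) ^ 2 + (s * (t + l * a)) ^ 2 := by
    rw [← hx, ← hy]; linear_combination (-ρ ^ 2) * hxy
  have hsum : |t + l * a| ≤ (65 / 48) * s := by
    have h1 : |l| * |a| ≤ s * (4 / 3) := mul_le_mul hl ha'.le (abs_nonneg _) hs0.le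
    have h2 : |t + l * a| ≤ |t| + |l| * |a| := by
      simpa [abs_mul] using abs_add_le t (l * a)
    linarith
  constructor
  · have h1 : |s ^ 2 * a| ≤ |ρ| :=
      sq_le_sq.mp (by rw [hρ]; nlinarith [sq_nonneg (s * (t + l * a))])
    rw [abs_mul, abs_of_pos (by positivity : 0 < s ^ 2)] at h1
    nlinarith [pow_pos hs0 2]
  · have hbound : ρ ^ 2 < (2 * s ^ 2) ^ 2 := by
      have h1 : a ^ 2 ≤ (4 / 3) ^ 2 :=
        sq_le_sq' (by linarith [neg_abs_le a]) (by linarith [le_abs_self a])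
      have h2 : (t + l * a) ^ 2 ≤ ((65 / 48) * s) ^ 2 :=
        sq_le_sq' (by linarith [neg_abs_le (t + l * a)]) (by linarith [le_abs_self (t + l * a)])
      have h3 : (s ^ 2 * a) ^ 2 ≤ s ^ 4 * (4 / 3) ^ 2 := by
        calc (s ^ 2 * a) ^ 2 = s ^ 4 * a ^ 2 := by ring
          _ ≤ _ := by gcongr
      have h4 : (s * (t + l * a)) ^ 2 ≤ s ^ 4 * (65 / 48) ^ 2 := by
        calc (s * (t + l * a)) ^ 2 = s ^ 2 * (t + l * a) ^ 2 := by ring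
          _ ≤ s ^ 2 * ((65 / 48) * s) ^ 2 := by gcongr
          _ = _ := by ring
      rw [hρ]
      nlinarith [pow_pos hs0 4]
    exact abs_lt_of_sq_lt_sq hbound (by positivity)

/-- The support of a horizontal window, with scale `s = 2^{j/2}`, lies in the horizontal wedge. -/
theorem IsWindow.mem_wedge {g : ℝ → ℝ} (hg : IsWindow g) {s l ρ θ : ℝ} (hs : 32 ≤ s)
    (hl : |l| ≤ s) (hθ : θ ∈ Icc (-(π / 2)) (π / 2))
    (hsupp : PsiH g ((s ^ 2)⁻¹ * (ρ * cos θ),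
      s⁻¹ * (ρ * sin θ) - l * (s ^ 2)⁻¹ * (ρ * cos θ)) ≠ 0) :
    (s ^ 2 / 3 < |ρ| ∧ |ρ| < 2 * s ^ 2) ∧
      arctan ((l - 2) * s⁻¹) < θ ∧ θ < arctan ((l + 2) * s⁻¹) := by
  have hs0 : 0 < s := by linarith
  obtain ⟨hga, hgt⟩ := mul_ne_zero_iff.mp hsupp
  obtain ⟨ha, ha'⟩ := hg.abs_bounds_of_gtilde_ne_zero hga
  have ht := hg.abs_lt hgt
  dsimp only at ha ha' ht
  set a := (s ^ 2)⁻¹ * (ρ * cos θ) with ha_def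
  set t := s⁻¹ * (ρ * sin θ) - l * (s ^ 2)⁻¹ * (ρ * cos θ) with ht_def
  have hx : ρ * cos θ = s ^ 2 * a := by rw [ha_def]; field_simp
  have hy : ρ * sin θ = s * (t + l * a) := by rw [ha_def, ht_def]; field_simp; ring
  refine ⟨radius_bounds hs hl (cos_sq_add_sin_sq θ) hx hy ha ha' ht, ?_⟩
  have hcos : cos θ ≠ 0 := by
    intro h
    rw [ha_def, h] at ha
    norm_num at ha
  have hlo : -(π / 2) < θ := lt_of_le_of_ne hθ.1 (by rintro rfl; simp at hcos)
  have hhi : θ < π / 2 := lt_of_le_of_ne hθ.2 (by rintro rfl; simp at hcos)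
  have hcos_pos : 0 < cos θ := cos_pos_of_mem_Ioo ⟨hlo, hhi⟩
  have hslope : |s * sin θ - l * cos θ| < 2 * cos θ := by
    have h1 : |ρ| * |s * sin θ - l * cos θ| = s ^ 2 * |t| := by
      rw [← abs_mul, ← abs_of_pos (by positivity : 0 < s ^ 2), ← abs_mul]
      congr 1
      linear_combination s * hy - l * hx
    have h2 : |ρ| * cos θ = s ^ 2 * |a| := by
      rw [← abs_of_pos hcos_pos, ← abs_mul, hx, abs_mul,
        abs_of_pos (by positivity : 0 < s ^ 2)]
    refine lt_of_mul_lt_mul_left ?_ (abs_nonneg ρ)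
    calc |ρ| * |s * sin θ - l * cos θ| = s ^ 2 * |t| := h1
      _ < s ^ 2 * (2 * |a|) := by gcongr; linarith
      _ = |ρ| * (2 * cos θ) := by linear_combination (-2) * h2
  obtain ⟨h1, h2⟩ := _root_.abs_lt.mp hslope
  rw [← arctan_tan hlo hhi, arctan_lt_arctan_iff, arctan_lt_arctan_iff, tan_eq_sin_div_cos,
    ← div_eq_mul_inv, ← div_eq_mul_inv, div_lt_div_iff₀ hs0 hcos_pos,
    div_lt_div_iff₀ hcos_pos hs0]
  constructor <;> linarith

/-- For even `j ≥ 10`, `|ℓ| ≤ 2^{j/2}`, in polar coordinates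
`ξ = ρ(cos θ, sin θ)ᵀ`, the support of `Ψ_{j,ℓ}^{(i)}` is contained in the wedge
`W_{j,ℓ}^{(i)}`. -/
theorem support_PsiJL (g : ℝ → ℝ) (hg : IsWindow g) (j : ℕ) (hj : Even j) (hj10 : 10 ≤ j)
    (ℓ : ℤ) (hℓ : |(ℓ : ℝ)| ≤ (2:ℝ)^((j:ℝ)/2)) (i : Bool) (ρ θ : ℝ)
    (hθ : if i then θ ∈ Icc (-(π/2)) (π/2) else θ ∈ Icc (0:ℝ) π)
    (hsupp : PsiJL g i j ℓ (ρ * Real.cos θ, ρ * Real.sin θ) ≠ 0) :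
    ((2:ℝ)^(j:ℝ)/3 < |ρ| ∧ |ρ| < (2:ℝ)^((j:ℝ)+1)) ∧
    (if i then thetaJL i j (ℓ-2) < θ ∧ θ < thetaJL i j (ℓ+2)
     else thetaJL i j (ℓ+2) < θ ∧ θ < thetaJL i j (ℓ-2)) := by
  set s : ℝ := (2:ℝ) ^ ((j:ℝ) / 2) with hs_def
  have hs : 32 ≤ s := by
    have h5 : (5:ℝ) ≤ (j:ℝ) / 2 := by
      have : (10:ℝ) ≤ j := by exact_mod_cast hj10
      linarith
    calc (32:ℝ) = (2:ℝ) ^ (5:ℝ) := by norm_num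
      _ ≤ s := rpow_le_rpow_of_exponent_le one_le_two h5
  have hsq : (2:ℝ) ^ (j:ℝ) = s ^ 2 := by
    rw [hs_def, sq, ← rpow_add two_pos, add_halves]
  have hinv : (2:ℝ) ^ (-(j:ℝ) / 2) = s⁻¹ := by
    rw [neg_div, rpow_neg two_pos.le]
  have hsqinv : (2:ℝ) ^ (-(j:ℝ)) = (s ^ 2)⁻¹ := by
    rw [rpow_neg two_pos.le, hsq]
  have hsucc : (2:ℝ) ^ ((j:ℝ) + 1) = 2 * s ^ 2 := by
    rw [rpow_add two_pos, hsq, rpow_one, mul_comm]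
  rw [hsucc, hsq]
  cases i
  · simp only [PsiJL, thetaJL, Bool.false_eq_true, if_false, hinv, hsqinv] at hθ hsupp ⊢
    have hwedge := hg.mem_wedge (ρ := ρ) (θ := π / 2 - θ) hs hℓ
      ⟨by linarith [hθ.2], by linarith [hθ.1]⟩
      (by rw [cos_pi_div_two_sub, sin_pi_div_two_sub]
          simpa only [PsiH, PsiV, mul_comm] using hsupp)
    push_cast
    exact ⟨hwedge.1, by linarith [hwedge.2.2], by linarith [hwedge.2.1]⟩
  · simp only [PsiJL, thetaJL, if_true, hinv, hsqinv] at hθ hsupp ⊢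
    push_cast
    exact hg.mem_wedge hs hℓ hθ hsupp
end
end

section
/- For i ∈ {h,v} and q ∈ ℕ₀ let Ψ^{(i)} ∈ W₂^q. Then for every multi-index r = (r₁, r₂) ∈ ℕ₀² with |r|₁ = r₁ + r₂ ≤ q and every rotation matrix R_γ = [[cos γ, −sin γ],[sin γ, cos γ]] with γ ∈ [0, 2π), there is a constant C(q) > 0 (independent of j, ℓ, γ, ξ) such that for all ξ ∈ ℝ²: |∂^r[Ψ_{j,ℓ}^{(i)}(R_γ ·)](ξ)| ≤ C(q) · 2^{−j|r|₁} · (1 + 2^{(j+1)/2}|sin(θ_{j,ℓ}^{(i)} − γ)|)^{r₁} · (1 + 2^{(j+1)/2}|cos(θ_{j,ℓ}^{(i)} − γ)|)^{r₂}. -/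
open Real MeasureTheory Set
open scoped Classical

noncomputable section

/-- `DerivProdSum u v L M n A f` says that `f` is a linear combination, with coefficients of total
absolute value at most `A`, of products `u⁽ᵏ⁾(L x) v⁽ᵐ⁾(M x)` with `k + m = n`. -/
inductive DerivProdSum (u v : ℝ → ℝ) (L M : ℝ × ℝ → ℝ) (n : ℕ) : ℝ → (ℝ × ℝ → ℝ) → Prop
  | prod (k m : ℕ) (h : k + m = n) :
      DerivProdSum u v L M n 1 (fun x => iteratedDeriv k u (L x) * iteratedDeriv m v (M x))
  | add {A B : ℝ} {f g : ℝ × ℝ → ℝ} (hf : DerivProdSum u v L M n A f)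
      (hg : DerivProdSum u v L M n B g) : DerivProdSum u v L M n (A + B) (fun x => f x + g x)
  | smul {A : ℝ} {f : ℝ × ℝ → ℝ} (c : ℝ) (hf : DerivProdSum u v L M n A f) :
      DerivProdSum u v L M n (|c| * A) (fun x => c * f x)

namespace DerivProdSum

variable {u v : ℝ → ℝ} {L M : ℝ × ℝ → ℝ} {n q : ℕ} {A : ℝ} {f : ℝ × ℝ → ℝ}

theorem abs_le {B : ℝ} (hu : ∀ k ≤ q, ∀ x, |iteratedDeriv k u x| ≤ B)
    (hv : ∀ k ≤ q, ∀ x, |iteratedDeriv k v x| ≤ B) (hn : n ≤ q)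
    (hf : DerivProdSum u v L M n A f) (x : ℝ × ℝ) : |f x| ≤ A * B ^ 2 := by
  induction hf with
  | prod k m h =>
    rw [abs_mul, one_mul, sq]
    exact mul_le_mul (hu k (by omega) _) (hv m (by omega) _) (abs_nonneg _)
      ((abs_nonneg _).trans (hu 0 (Nat.zero_le _) 0))
  | add _ _ ihf ihg =>
    rw [add_mul]
    exact (abs_add_le _ _).trans (add_le_add ihf ihg)
  | smul c _ ih =>
    rw [abs_mul, mul_assoc]
    exact mul_le_mul_of_nonneg_left ih (abs_nonneg c)

theorem exists_hasDerivAt (hu : ContDiff ℝ q u) (hv : ContDiff ℝ q v) (hn : n < q) (α β : ℝ)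
    (hf : DerivProdSum u v L M n A f) :
    ∃ f', DerivProdSum u v L M (n + 1) ((|α| + |β|) * A) f' ∧
      ∀ (p : ℝ → ℝ × ℝ) (t : ℝ), HasDerivAt (fun s => L (p s)) α t →
        HasDerivAt (fun s => M (p s)) β t → HasDerivAt (fun s => f (p s)) (f' (p t)) t := by
  have key {w : ℝ → ℝ} (hw : ContDiff ℝ q w) {k : ℕ} (hk : k < q) (y : ℝ) :
      HasDerivAt (iteratedDeriv k w) (iteratedDeriv (k + 1) w y) y := by
    rw [iteratedDeriv_succ]
    exact ((hw.differentiable_iteratedDeriv k (by exact_mod_cast hk)) y).hasDerivAt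
  induction hf with
  | prod k m h =>
    refine ⟨fun x => α * (iteratedDeriv (k + 1) u (L x) * iteratedDeriv m v (M x)) +
      β * (iteratedDeriv k u (L x) * iteratedDeriv (m + 1) v (M x)), ?_, fun p t hL hM => ?_⟩
    · rw [add_mul]
      exact ((prod (k + 1) m (by omega)).smul α).add ((prod k (m + 1) (by omega)).smul β)
    · have h₁ := (key hu (show k < q by omega) (L (p t))).comp t hL
      have h₂ := (key hv (show m < q by omega) (M (p t))).comp t hM
      refine (h₁.mul h₂).congr_deriv ?_
      simp only [Function.comp_apply]
      ring
  | add _ _ ihf ihg =>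
    obtain ⟨f', hf', hfd⟩ := ihf
    obtain ⟨g', hg', hgd⟩ := ihg
    refine ⟨fun x => f' x + g' x, ?_, fun p t hL hM => (hfd p t hL hM).add (hgd p t hL hM)⟩
    rw [mul_add]
    exact hf'.add hg'
  | smul c _ ih =>
    obtain ⟨f', hf', hfd⟩ := ih
    refine ⟨fun x => c * f' x, ?_, fun p t hL hM => (hfd p t hL hM).const_mul c⟩
    rw [mul_left_comm]
    exact hf'.smul c

variable {a₁ a₂ b₁ b₂ : ℝ}

theorem pdR1 (hu : ContDiff ℝ q u) (hv : ContDiff ℝ q v) (hn : n < q)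
    (hL : ∀ x, L x = a₁ * x.1 + a₂ * x.2) (hM : ∀ x, M x = b₁ * x.1 + b₂ * x.2)
    (hf : DerivProdSum u v L M n A f) :
    DerivProdSum u v L M (n + 1) ((|a₁| + |b₁|) * A) (pdR1 f) := by
  obtain ⟨f', hf', hfd⟩ := hf.exists_hasDerivAt hu hv hn a₁ b₁
  convert hf' using 1
  funext x
  refine (hfd (fun t => (t, x.2)) x.1 ?_ ?_).deriv
  · simpa [hL] using ((hasDerivAt_id x.1).const_mul a₁).add_const (a₂ * x.2)
  · simpa [hM] using ((hasDerivAt_id x.1).const_mul b₁).add_const (b₂ * x.2)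

theorem pdR2 (hu : ContDiff ℝ q u) (hv : ContDiff ℝ q v) (hn : n < q)
    (hL : ∀ x, L x = a₁ * x.1 + a₂ * x.2) (hM : ∀ x, M x = b₁ * x.1 + b₂ * x.2)
    (hf : DerivProdSum u v L M n A f) :
    DerivProdSum u v L M (n + 1) ((|a₂| + |b₂|) * A) (pdR2 f) := by
  obtain ⟨f', hf', hfd⟩ := hf.exists_hasDerivAt hu hv hn a₂ b₂
  convert hf' using 1
  funext x
  refine (hfd (fun t => (x.1, t)) x.2 ?_ ?_).deriv
  · simpa [hL] using ((hasDerivAt_id x.2).const_mul a₂).const_add (a₁ * x.1)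
  · simpa [hM] using ((hasDerivAt_id x.2).const_mul b₂).const_add (b₁ * x.1)

theorem pdR (hu : ContDiff ℝ q u) (hv : ContDiff ℝ q v)
    (hL : ∀ x, L x = a₁ * x.1 + a₂ * x.2) (hM : ∀ x, M x = b₁ * x.1 + b₂ * x.2)
    (r : ℕ × ℕ) (hr : r.1 + r.2 ≤ q) :
    DerivProdSum u v L M (r.1 + r.2) ((|a₁| + |b₁|) ^ r.1 * (|a₂| + |b₂|) ^ r.2)
      (pdR r fun x => u (L x) * v (M x)) := by
  obtain ⟨r₁, r₂⟩ := r
  simp only [_root_.pdR] at hr ⊢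
  induction r₁ with
  | zero =>
    simp only [pow_zero, one_mul, zero_add, Function.iterate_zero, id] at hr ⊢
    induction r₂ with
    | zero => simpa using prod (u := u) (v := v) (L := L) (M := M) 0 0 rfl
    | succ m ih =>
      rw [Function.iterate_succ_apply', pow_succ']
      exact (ih (by omega)).pdR2 hu hv (by omega) hL hM
  | succ k ih =>
    rw [Function.iterate_succ_apply', pow_succ', mul_assoc, Nat.add_right_comm]
    exact (ih (by omega)).pdR1 hu hv (by omega) hL hM

end DerivProdSum

theorem abs_pdR_prod_le {u v : ℝ → ℝ} {q : ℕ} {B a₁ a₂ b₁ b₂ s₁ s₂ : ℝ}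
    (hu : ContDiff ℝ q u) (hv : ContDiff ℝ q v)
    (hBu : ∀ k ≤ q, ∀ x, |iteratedDeriv k u x| ≤ B) (hBv : ∀ k ≤ q, ∀ x, |iteratedDeriv k v x| ≤ B)
    (h₁ : |a₁| + |b₁| ≤ s₁) (h₂ : |a₂| + |b₂| ≤ s₂)
    (r : ℕ × ℕ) (hr : r.1 + r.2 ≤ q) (ξ : ℝ × ℝ) :
    |pdR r (fun x => u (a₁ * x.1 + a₂ * x.2) * v (b₁ * x.1 + b₂ * x.2)) ξ|
      ≤ s₁ ^ r.1 * s₂ ^ r.2 * B ^ 2 := by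
  refine ((DerivProdSum.pdR hu hv (fun _ => rfl) (fun _ => rfl) r hr).abs_le hBu hBv hr ξ).trans ?_
  have hs₁ : 0 ≤ s₁ := le_trans (by positivity) h₁
  gcongr

theorem exists_bound_iteratedDeriv {u : ℝ → ℝ} {q : ℕ} (hu : ContDiff ℝ q u)
    (hc : HasCompactSupport u) : ∃ B, ∀ k ≤ q, ∀ x, |iteratedDeriv k u x| ≤ B := by
  have h (k : ℕ) : ∃ C, k ≤ q → ∀ x, |iteratedDeriv k u x| ≤ C := by
    by_cases hk : k ≤ q
    · have hk' : (k : WithTop ℕ∞) ≤ q := by exact_mod_cast hk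
      obtain ⟨C, hC⟩ := (hc.iteratedFDeriv (𝕜 := ℝ) k).exists_bound_of_continuous
        (hu.continuous_iteratedFDeriv hk')
      exact ⟨C, fun _ x => by
        simpa [norm_iteratedFDeriv_eq_norm_iteratedDeriv] using hC x⟩
    · exact ⟨0, fun h => absurd h hk⟩
  choose C hC using h
  obtain ⟨B, hB⟩ := ((Finset.range (q + 1)).image C).bddAbove
  exact ⟨B, fun k hk x => (hC k hk x).trans <| hB <| by
    simpa using ⟨k, by omega, rfl⟩⟩

theorem IsWindow.hasCompactSupport {g : ℝ → ℝ} (hg : IsWindow g) : HasCompactSupport g :=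
  HasCompactSupport.of_support_subset_isCompact isCompact_Icc
    (hg.supp_eq.subset.trans Ioo_subset_Icc_self)

theorem IsWindow.hasCompactSupport_gtilde {g : ℝ → ℝ} (hg : IsWindow g) :
    HasCompactSupport (gtilde g) := by
  refine HasCompactSupport.intro (isCompact_Icc (a := -(4 / 3 : ℝ)) (b := 4 / 3)) fun x hx => ?_
  have h₀ : ∀ y : ℝ, y ∉ Ioo (-(2 / 3) : ℝ) (2 / 3) → g y = 0 := fun y hy => by
    rwa [← hg.supp_eq, Function.notMem_support] at hy
  rw [gtilde, h₀, h₀, sub_zero] <;>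
  · refine fun h => hx ⟨?_, ?_⟩ <;> linarith [h.1, h.2]

theorem contDiff_gtilde {g : ℝ → ℝ} {q : ℕ} (hg : ContDiff ℝ q g) : ContDiff ℝ q (gtilde g) :=
  (hg.comp (contDiff_id.div_const 2)).sub hg

/-- The coefficient bound coming from `(cos (arctan t))⁻¹ ≤ √2` for `|t| ≤ 1`. -/
theorem abs_div_cos_arctan_le {t : ℝ} (ht : |t| ≤ 1) (x : ℝ) :
    |x / cos (arctan t)| ≤ 2 ^ (1 / 2 : ℝ) * |x| := by
  rw [cos_arctan, div_div_eq_mul_div, div_one, abs_mul, abs_of_nonneg (sqrt_nonneg _),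
    ← sqrt_eq_rpow, mul_comm]
  gcongr
  nlinarith [abs_le.mp ht]

theorem two_rpow_half_split (j : ℕ) :
    (2 : ℝ) ^ (-(j : ℝ) / 2) * 2 ^ (1 / 2 : ℝ) = 2 ^ (-(j : ℝ)) * 2 ^ (((j : ℝ) + 1) / 2) := by
  rw [← rpow_add two_pos, ← rpow_add two_pos]
  ring_nf

theorem two_rpow_neg_eq_sq (j : ℕ) :
    (2 : ℝ) ^ (-(j : ℝ)) = 2 ^ (-(j : ℝ) / 2) * 2 ^ (-(j : ℝ) / 2) := by
  rw [← rpow_add two_pos]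
  ring_nf

/-- If `a` has modulus at most `2⁻ʲ` and `b = 2^(-j/2) x / cos (arctan t)` with `|t| ≤ 1`, then
`|a| + |b| ≤ 2⁻ʲ (1 + 2^((j+1)/2) |x|)`. -/
theorem abs_add_abs_coeff_le {t c a b x : ℝ} (j : ℕ) (ht : |t| ≤ 1) (hc : |c| ≤ 1)
    (ha : a = 2 ^ (-(j : ℝ)) * c) (hb : b = 2 ^ (-(j : ℝ) / 2) * (x / cos (arctan t))) :
    |a| + |b| ≤ 2 ^ (-(j : ℝ)) * (1 + 2 ^ (((j : ℝ) + 1) / 2) * |x|) := by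
  have h₁ : (0 : ℝ) < 2 ^ (-(j : ℝ)) := rpow_pos_of_pos two_pos _
  have h₂ : (0 : ℝ) < 2 ^ (-(j : ℝ) / 2) := rpow_pos_of_pos two_pos _
  rw [ha, hb, abs_mul, abs_mul, abs_of_pos h₁, abs_of_pos h₂, mul_add, ← mul_assoc _ _ |x|,
    ← two_rpow_half_split, mul_assoc _ _ |x|]
  gcongr
  exact abs_div_cos_arctan_le ht x

/-- Derivative bounds for the rotated windows `Ψ_{j,ℓ}^{(i)}(R_γ ·)`:
for `Ψ^{(i)} ∈ 𝒲₂^q` and any multi-index `r` with `|r|₁ ≤ q` there is `C(q) > 0`,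
independent of `j`, `ℓ`, `γ` and `ξ`, such that
`|∂^r[Ψ_{j,ℓ}^{(i)}(R_γ ·)](ξ)| ≤ C 2^{-j|r|₁} (1 + 2^{(j+1)/2}|sin(θ_{j,ℓ}^{(i)} − γ)|)^{r₁}
(1 + 2^{(j+1)/2}|cos(θ_{j,ℓ}^{(i)} − γ)|)^{r₂}`. -/
theorem deriv_bound_rotated_PsiJL (g : ℝ → ℝ) (q : ℕ) (hg : IsWindowQ g q)
    (i : Bool) (r : ℕ × ℕ) (hr : r.1 + r.2 ≤ q) :
    ∃ C > 0, ∀ (j : ℕ), Even j → ∀ (ℓ : ℤ), |(ℓ : ℝ)| ≤ (2:ℝ)^((j:ℝ)/2) →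
      ∀ γ ∈ Ico (0:ℝ) (2*π), ∀ ξ : ℝ × ℝ,
        |pdR r (fun x => PsiJL g i j ℓ (rotM γ x)) ξ|
          ≤ C * (2:ℝ)^(-(j:ℝ)*((r.1:ℝ)+(r.2:ℝ))) *
            (1 + (2:ℝ)^(((j:ℝ)+1)/2) * |Real.sin (thetaJL i j ℓ - γ)|)^(r.1:ℝ) *
            (1 + (2:ℝ)^(((j:ℝ)+1)/2) * |Real.cos (thetaJL i j ℓ - γ)|)^(r.2:ℝ) := by
  obtain ⟨hw, hgC⟩ := hg
  have hGC := contDiff_gtilde hgC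
  obtain ⟨B₁, hB₁⟩ := exists_bound_iteratedDeriv hgC hw.hasCompactSupport
  obtain ⟨B₂, hB₂⟩ := exists_bound_iteratedDeriv hGC hw.hasCompactSupport_gtilde
  have hBg : ∀ k ≤ q, ∀ x, |iteratedDeriv k g x| ≤ max B₁ B₂ := fun k hk x =>
    (hB₁ k hk x).trans (le_max_left _ _)
  have hBG : ∀ k ≤ q, ∀ x, |iteratedDeriv k (gtilde g) x| ≤ max B₁ B₂ := fun k hk x =>
    (hB₂ k hk x).trans (le_max_right _ _)
  refine ⟨max B₁ B₂ ^ 2 + 1, by positivity, fun j _ ℓ hℓ γ _ ξ => ?_⟩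
  set e : ℝ := 2 ^ (-(j : ℝ) / 2) with he
  set t : ℝ := (ℓ : ℝ) * e with ht
  have he0 : 0 < e := rpow_pos_of_pos two_pos _
  have ht1 : |t| ≤ 1 := by
    have h : (2 : ℝ) ^ ((j : ℝ) / 2) * e = 1 := by
      rw [he, ← rpow_add two_pos]
      ring_nf
      exact rpow_zero _
    rw [ht, abs_mul, abs_of_pos he0, ← h]
    gcongr
  have hcos : cos (arctan t) ≠ 0 := (cos_arctan_pos t).ne'
  have hsin : sin (arctan t) = t * cos (arctan t) := by
    rw [← tan_mul_cos hcos, tan_arctan]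
  have hee : (2 : ℝ) ^ (-(j : ℝ)) = e * e := two_rpow_neg_eq_sq j
  set s₁ := 1 + (2 : ℝ) ^ (((j : ℝ) + 1) / 2) * |sin (thetaJL i j ℓ - γ)| with hs₁
  set s₂ := 1 + (2 : ℝ) ^ (((j : ℝ) + 1) / 2) * |cos (thetaJL i j ℓ - γ)| with hs₂
  have hs₁0 : 0 < s₁ := by positivity
  have hs₂0 : 0 < s₂ := by positivity
  suffices h : |pdR r (fun x => PsiJL g i j ℓ (rotM γ x)) ξ| ≤
      (2 ^ (-(j : ℝ)) * s₁) ^ r.1 * (2 ^ (-(j : ℝ)) * s₂) ^ r.2 * max B₁ B₂ ^ 2 by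
    have hp : (2 : ℝ) ^ (-(j : ℝ) * ((r.1 : ℝ) + (r.2 : ℝ))) =
        (2 ^ (-(j : ℝ))) ^ r.1 * (2 ^ (-(j : ℝ))) ^ r.2 := by
      rw [rpow_mul two_pos.le, ← Nat.cast_add, rpow_natCast, pow_add]
    rw [hp, rpow_natCast, rpow_natCast]
    refine h.trans ?_
    rw [mul_pow, mul_pow]
    have : 0 ≤ (2 ^ (-(j : ℝ))) ^ r.1 * s₁ ^ r.1 * ((2 ^ (-(j : ℝ))) ^ r.2 * s₂ ^ r.2) := by
      positivity
    linarith
  cases i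
  · have hθ : thetaJL false j ℓ - γ = π / 2 - (arctan t + γ) := by
      simp only [thetaJL, Bool.false_eq_true, if_false]
      ring
    rw [hθ, sin_pi_div_two_sub] at hs₁
    rw [hθ, cos_pi_div_two_sub] at hs₂
    have h₁ : |2 ^ (-(j : ℝ)) * sin γ| + |e * (cos γ - t * sin γ)| ≤ 2 ^ (-(j : ℝ)) * s₁ := by
      rw [hs₁]
      refine abs_add_abs_coeff_le j ht1 (abs_sin_le_one γ) rfl ?_
      rw [← he, cos_add, hsin]
      field_simp
    have h₂ : |2 ^ (-(j : ℝ)) * cos γ| + |e * (-sin γ - t * cos γ)| ≤ 2 ^ (-(j : ℝ)) * s₂ := by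
      rw [hs₂, ← abs_neg (sin (arctan t + γ))]
      refine abs_add_abs_coeff_le j ht1 (abs_cos_le_one γ) rfl ?_
      rw [← he, sin_add, hsin]
      field_simp
      ring
    convert abs_pdR_prod_le hGC hgC hBG hBg h₁ h₂ r hr ξ using 4 with x
    simp only [PsiJL, PsiV, rotM, Bool.false_eq_true, if_false, hee, ht, ← he]
    rw [mul_comm (g _)]
    congr 2 <;> ring
  · have hθ : thetaJL true j ℓ - γ = arctan t - γ := by
      simp only [thetaJL, if_true]
      rfl
    rw [hθ] at hs₁ hs₂
    have h₁ : |2 ^ (-(j : ℝ)) * cos γ| + |e * (sin γ - t * cos γ)| ≤ 2 ^ (-(j : ℝ)) * s₁ := by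
      rw [hs₁, ← abs_neg (sin (arctan t - γ))]
      refine abs_add_abs_coeff_le j ht1 (abs_cos_le_one γ) rfl ?_
      rw [← he, sin_sub, hsin]
      field_simp
      ring
    have h₂ : |2 ^ (-(j : ℝ)) * -sin γ| + |e * (cos γ + t * sin γ)| ≤ 2 ^ (-(j : ℝ)) * s₂ := by
      rw [hs₂]
      refine abs_add_abs_coeff_le j ht1 ((abs_neg _).trans_le (abs_sin_le_one γ)) rfl ?_
      rw [← he, cos_sub, hsin]
      field_simp
    convert abs_pdR_prod_le hGC hgC hBG hBg h₁ h₂ r hr ξ using 4 with x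
    simp only [PsiJL, PsiH, rotM, if_true, hee, ht, ← he]
    congr 2 <;> ring
end
end
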